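/- For any complex number t and positive integer m, Σ_{k=0}^{2m} (−1)^k · binom(2m, k) · binom(t + 1/2, 4m + 1 − k) · binom(t − 1/2, 2m + 1 + k) = A_m · binom(t + m + 1/2, 3m + 1) · binom(t − 1/2, 3m + 1), where A_m = (−1)^m · binom(2m, m) / binom(4m+1, m). -/

import Mathlib

/-- Generalized binomial coefficient `(x choose n)` over `ℂ`. -/
noncomputable def gbinomC (x : ℂ) (n : ℕ) : ℂ :=
  (descPochhammer ℂ n).eval x / n.factorial

lemma gbinomC_natCast (n k : ℕ) : gbinomC (n : ℂ) k = (Nat.choose n k : ℂ) := by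
  rw [gbinomC, Nat.cast_choose_eq_descPochhammer_div]

lemma gbinomC_pred (x : ℂ) (n : ℕ) : x * gbinomC (x - 1) n = (x - n) * gbinomC x n := by
  have h1 : (descPochhammer ℂ (n + 1)).eval x = x * (descPochhammer ℂ n).eval (x - 1) := by
    rw [descPochhammer_succ_left]; simp
  have h2 : (descPochhammer ℂ (n + 1)).eval x = (descPochhammer ℂ n).eval x * (x - n) := by
    rw [descPochhammer_succ_eval]
  unfold gbinomC
  rw [← mul_div_assoc, ← h1, h2]; ring

lemma choose_step (x u : ℕ) :
    (Nat.choose x (u + 1) : ℂ) = (x - u) / (u + 1) * Nat.choose x u := by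
  have hu : ((u : ℂ) + 1) ≠ 0 := by exact_mod_cast Nat.succ_ne_zero u
  have h : (Nat.choose x (u + 1) : ℂ) * (u + 1) = Nat.choose x u * (x - u) := by
    rcases le_or_gt u x with hx | hx
    · have := Nat.choose_succ_right_eq x u
      rw [← Nat.cast_sub hx]; exact_mod_cast this
    · rw [Nat.choose_eq_zero_of_lt hx, Nat.choose_eq_zero_of_lt (by omega)]; simp
  field_simp
  linear_combination h

/-- Dixon summand; the lower parameter is `p + 1`. -/
noncomputable def dixF (m p x k : ℕ) : ℂ :=
  (-1 : ℂ) ^ k * (Nat.choose (2 * m) k : ℂ) *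
    (Nat.choose x (p + 1 + 2 * m - k) : ℂ) * (Nat.choose x (p + 1 + k) : ℂ)

noncomputable def dixG (m p x k : ℕ) : ℂ :=
  -((x : ℂ) + 1) / 2 * ((-1 : ℂ) ^ k * k * (Nat.choose (2 * m) k : ℂ) *
    (Nat.choose x (p + 1 + 2 * m - k) : ℂ) * (Nat.choose x (p + k) : ℂ))

lemma dix_term (m p x k : ℕ) (hk : k ≤ 2 * m) :
    ((x : ℂ) - p) * (x - m - p) * dixF m p (x + 1) k - (x + 1 + m) * (x + 1) * dixF m p x k
      = dixG m p x (k + 1) - dixG m p x k := by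
  obtain ⟨l, hl⟩ := Nat.exists_eq_add_of_le hk
  have hm : (m : ℂ) = (k + l) / 2 := by
    have : (2 * m : ℂ) = k + l := by exact_mod_cast hl
    linear_combination this / 2
  unfold dixF dixG
  have e1 : p + 1 + 2 * m - k = (p + l) + 1 := by omega
  have e2 : p + 1 + 2 * m - (k + 1) = p + l := by omega
  have e3 : p + 1 + k = (p + k) + 1 := by omega
  have e4 : p + (k + 1) = (p + k) + 1 := by omega
  have e5 : (2 * m : ℂ) - k = l := by rw [hm]; ring
  have hk1 : ((k : ℂ) + 1) ≠ 0 := by exact_mod_cast Nat.succ_ne_zero k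
  have h1 : ((p : ℂ) + k + 1) ≠ 0 := by exact_mod_cast Nat.succ_ne_zero (p + k)
  have h2 : ((p : ℂ) + l + 1) ≠ 0 := by exact_mod_cast Nat.succ_ne_zero (p + l)
  rw [e1, e2, e3, e4, Nat.choose_succ_succ x, Nat.choose_succ_succ x]
  push_cast
  rw [choose_step x (p + l), choose_step x (p + k), choose_step (2 * m) k]
  push_cast
  rw [e5, hm]
  field_simp
  ring

lemma dix_rec (m p x : ℕ) :
    ((x : ℂ) - p) * (x - m - p) * ∑ k ∈ Finset.range (2 * m + 1), dixF m p (x + 1) k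
      = (x + 1 + m) * (x + 1) * ∑ k ∈ Finset.range (2 * m + 1), dixF m p x k := by
  rw [← sub_eq_zero, Finset.mul_sum, Finset.mul_sum, ← Finset.sum_sub_distrib,
    Finset.sum_congr rfl (fun k hk => dix_term m p x k (by
      have := Finset.mem_range.1 hk; omega)), Finset.sum_range_sub]
  simp [dixG]

lemma choose_top (x u : ℕ) :
    ((x : ℂ) + 1 - u) * (Nat.choose (x + 1) u : ℂ) = (x + 1) * Nat.choose x u := by
  have := gbinomC_pred ((x + 1 : ℕ) : ℂ) u
  rw [gbinomC_natCast] at this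
  push_cast at this
  rw [add_sub_cancel_right, gbinomC_natCast] at this
  exact this.symm

lemma dixon (m p n : ℕ) :
    (Nat.choose (2 * m + (p + 1)) m : ℂ) *
        ∑ k ∈ Finset.range (2 * m + 1), dixF m p (m + (p + 1) + n) k
      = (-1 : ℂ) ^ m * (Nat.choose (2 * m) m : ℂ) *
        (Nat.choose (m + (p + 1) + n + m) (m + (p + 1)) : ℂ) *
        (Nat.choose (m + (p + 1) + n) (m + (p + 1)) : ℂ) := by
  induction n with
  | zero =>
    rw [Finset.sum_eq_single m]
    · unfold dixF
      have e1 : p + 1 + 2 * m - m = m + (p + 1) := by omega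
      have e2 : p + 1 + m = m + (p + 1) := by omega
      have e3 : Nat.choose (m + (p + 1) + 0 + m) (m + (p + 1)) =
          Nat.choose (2 * m + (p + 1)) m := by
        rw [show m + (p + 1) + 0 + m = m + (p + 1) + m by omega, Nat.choose_symm_add]
        congr 1; omega
      rw [e1, e2, e3]
      simp
      ring
    · intro k hk hkm
      have := Finset.mem_range.1 hk
      unfold dixF
      rcases lt_or_gt_of_ne hkm with h | h
      · rw [Nat.choose_eq_zero_of_lt (show m + (p + 1) + 0 < p + 1 + 2 * m - k by omega)]; simp
      · rw [Nat.choose_eq_zero_of_lt (show m + (p + 1) + 0 < p + 1 + k by omega)]; simp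
    · intro h; exact absurd (Finset.mem_range.2 (by omega)) h
  | succ n ih =>
    have hr := dix_rec m p (m + (p + 1) + n)
    have t1 := choose_top (m + (p + 1) + n) (m + (p + 1))
    have t2 := choose_top (m + (p + 1) + n + m) (m + (p + 1))
    rw [show m + (p + 1) + n + m + 1 = m + (p + 1) + (n + 1) + m by omega] at t2
    rw [show m + (p + 1) + n + 1 = m + (p + 1) + (n + 1) by omega] at hr t1
    have c1 : ((m + n + 1 : ℕ) : ℂ) ≠ 0 := Nat.cast_ne_zero.2 (by omega)
    have c2 : ((n + 1 : ℕ) : ℂ) ≠ 0 := Nat.cast_ne_zero.2 (by omega)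
    apply mul_left_cancel₀ (mul_ne_zero c1 c2)
    generalize (∑ k ∈ Finset.range (2 * m + 1), dixF m p (m + (p + 1) + (n + 1)) k) = S1 at *
    generalize (∑ k ∈ Finset.range (2 * m + 1), dixF m p (m + (p + 1) + n) k) = S0 at *
    generalize (Nat.choose (m + (p + 1) + (n + 1) + m) (m + (p + 1)) : ℂ) = A1 at *
    generalize (Nat.choose (m + (p + 1) + n + m) (m + (p + 1)) : ℂ) = A0 at *
    generalize (Nat.choose (m + (p + 1) + (n + 1)) (m + (p + 1)) : ℂ) = B1 at *
    generalize (Nat.choose (m + (p + 1) + n) (m + (p + 1)) : ℂ) = B0 at *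
    generalize (Nat.choose (2 * m + (p + 1)) m : ℂ) = D at *
    generalize (-1 : ℂ) ^ m * (Nat.choose (2 * m) m : ℂ) = E at *
    push_cast at *
    have tt1 : ((n : ℂ) + 1) * B1 = (m + (p + 1) + n + 1) * B0 := by linear_combination t1
    have tt2 : ((m : ℂ) + n + 1) * A1 = (m + (p + 1) + n + m + 1) * A0 := by
      linear_combination t2
    have hrr : ((m : ℂ) + n + 1) * (n + 1) * S1
        = (m + (p + 1) + n + m + 1) * (m + (p + 1) + n + 1) * S0 := by linear_combination hr
    linear_combination D * hrr + (m + (p + 1) + n + m + 1) * (m + (p + 1) + n + 1) * ih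
      - E * (n + 1) * B1 * tt2 - E * (m + (p + 1) + n + m + 1) * A0 * tt1

/-- The two sides of the identity, in the variable `x = t + 1/2`. -/
noncomputable def lhsS (m : ℕ) (x : ℂ) : ℂ :=
  ∑ k ∈ Finset.range (2 * m + 1), (-1 : ℂ) ^ k * (Nat.choose (2 * m) k : ℂ) *
    gbinomC x (4 * m + 1 - k) * gbinomC (x - 1) (2 * m + 1 + k)

lemma lhsS_symm (m : ℕ) (x : ℂ) :
    x * lhsS m x = (x - (3 * m + 1)) * ∑ k ∈ Finset.range (2 * m + 1),
      (-1 : ℂ) ^ k * (Nat.choose (2 * m) k : ℂ) *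
        gbinomC x (4 * m + 1 - k) * gbinomC x (2 * m + 1 + k) := by
  have h : lhsS m x = ∑ k ∈ Finset.range (2 * m + 1), (-1 : ℂ) ^ k * (Nat.choose (2 * m) k : ℂ) *
      gbinomC (x - 1) (4 * m + 1 - k) * gbinomC x (2 * m + 1 + k) := by
    rw [lhsS, ← Finset.sum_range_reflect]
    refine Finset.sum_congr rfl fun k hk => ?_
    have hk : k ≤ 2 * m := by have := Finset.mem_range.1 hk; omega
    have e0 : 2 * m + 1 - 1 - k = 2 * m - k := by omega
    have e1 : 4 * m + 1 - (2 * m - k) = 2 * m + 1 + k := by omega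
    have e2 : 2 * m + 1 + (2 * m - k) = 4 * m + 1 - k := by omega
    have e3 : (-1 : ℂ) ^ (2 * m - k) = (-1) ^ k := by
      rw [neg_one_pow_eq_pow_mod_two, neg_one_pow_eq_pow_mod_two (n := k)]
      congr 1; omega
    rw [e0, e1, e2, e3, Nat.choose_symm hk]
    ring
  have h2 : 2 * (x * lhsS m x) = x * lhsS m x + x * lhsS m x := by ring
  suffices 2 * (x * lhsS m x) = 2 * ((x - (3 * m + 1)) * ∑ k ∈ Finset.range (2 * m + 1),
      (-1 : ℂ) ^ k * (Nat.choose (2 * m) k : ℂ) *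
        gbinomC x (4 * m + 1 - k) * gbinomC x (2 * m + 1 + k)) from
    mul_left_cancel₀ two_ne_zero this
  rw [h2]
  nth_rewrite 1 [h]
  rw [lhsS, Finset.mul_sum, Finset.mul_sum, Finset.mul_sum, Finset.mul_sum,
    ← Finset.sum_add_distrib]
  refine Finset.sum_congr rfl fun k hk => ?_
  have hk : k ≤ 4 * m + 1 := by have := Finset.mem_range.1 hk; omega
  have g1 := gbinomC_pred x (4 * m + 1 - k)
  have g2 := gbinomC_pred x (2 * m + 1 + k)
  rw [Nat.cast_sub hk] at g1
  push_cast at g1 g2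
  linear_combination (-1 : ℂ) ^ k * (Nat.choose (2 * m) k : ℂ) *
    (gbinomC x (2 * m + 1 + k) * g1 + gbinomC x (4 * m + 1 - k) * g2)

lemma main_nat (m n : ℕ) :
    lhsS m ((3 * m + 1 + n : ℕ) : ℂ) =
      ((-1 : ℂ) ^ m * (Nat.choose (2 * m) m : ℂ) / (Nat.choose (4 * m + 1) m : ℂ)) *
        gbinomC (((3 * m + 1 + n : ℕ) : ℂ) + m) (3 * m + 1) *
        gbinomC (((3 * m + 1 + n : ℕ) : ℂ) - 1) (3 * m + 1) := by
  have hs := lhsS_symm m ((3 * m + 1 + n : ℕ) : ℂ)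
  have hd := dixon m (2 * m) n
  have hp := gbinomC_pred ((3 * m + 1 + n : ℕ) : ℂ) (3 * m + 1)
  have hx : ((3 * m + 1 + n : ℕ) : ℂ) ≠ 0 := Nat.cast_ne_zero.2 (by omega)
  have hD : (Nat.choose (4 * m + 1) m : ℂ) ≠ 0 :=
    Nat.cast_ne_zero.2 (Nat.choose_pos (by omega)).ne'
  rw [show m + (2 * m + 1) = 3 * m + 1 by omega, show 2 * m + (2 * m + 1) = 4 * m + 1 by omega]
    at hd
  have hsum : (∑ k ∈ Finset.range (2 * m + 1), (-1 : ℂ) ^ k * (Nat.choose (2 * m) k : ℂ) *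
        gbinomC ((3 * m + 1 + n : ℕ) : ℂ) (4 * m + 1 - k) *
        gbinomC ((3 * m + 1 + n : ℕ) : ℂ) (2 * m + 1 + k)) =
      ∑ k ∈ Finset.range (2 * m + 1), dixF m (2 * m) (3 * m + 1 + n) k := by
    refine Finset.sum_congr rfl fun k _ => ?_
    rw [gbinomC_natCast, gbinomC_natCast, dixF,
      show 2 * m + 1 + 2 * m - k = 4 * m + 1 - k by omega]
  rw [hsum] at hs
  rw [← gbinomC_natCast (3 * m + 1 + n + m), ← gbinomC_natCast (3 * m + 1 + n),
    Nat.cast_add (3 * m + 1 + n) m] at hd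
  generalize ((3 * m + 1 + n : ℕ) : ℂ) = x at *
  push_cast at hp
  field_simp
  apply mul_left_cancel₀ hx
  linear_combination (Nat.choose (4 * m + 1) m : ℂ) * hs + (x - (3 * m + 1)) * hd
    - (-1 : ℂ) ^ m * (Nat.choose (2 * m) m : ℂ) * gbinomC (x + m) (3 * m + 1) * hp

open Polynomial in
/-- The polynomial whose value at `x` is `binom(x + c, n)`. -/
noncomputable def gpoly (c : ℂ) (n : ℕ) : ℂ[X] :=
  C ((n.factorial : ℂ)⁻¹) * (descPochhammer ℂ n).comp (X + C c)

lemma gpoly_eval (c x : ℂ) (n : ℕ) : (gpoly c n).eval x = gbinomC (x + c) n := by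
  simp [gpoly, gbinomC, div_eq_inv_mul]

open Polynomial in
lemma main_all (m : ℕ) (x : ℂ) :
    lhsS m x =
      ((-1 : ℂ) ^ m * (Nat.choose (2 * m) m : ℂ) / (Nat.choose (4 * m + 1) m : ℂ)) *
        gbinomC (x + m) (3 * m + 1) * gbinomC (x - 1) (3 * m + 1) := by
  let P : ℂ[X] := ∑ k ∈ Finset.range (2 * m + 1), C ((-1 : ℂ) ^ k * (Nat.choose (2 * m) k : ℂ)) *
    gpoly 0 (4 * m + 1 - k) * gpoly (-1) (2 * m + 1 + k)
  let Q : ℂ[X] :=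
    C ((-1 : ℂ) ^ m * (Nat.choose (2 * m) m : ℂ) / (Nat.choose (4 * m + 1) m : ℂ)) *
      gpoly m (3 * m + 1) * gpoly (-1) (3 * m + 1)
  have hP : ∀ y, P.eval y = lhsS m y := fun y => by
    simp only [P, lhsS, eval_finsetSum, eval_mul, eval_C, gpoly_eval, add_zero, sub_eq_add_neg]
  have hQ : ∀ y, Q.eval y = ((-1 : ℂ) ^ m * (Nat.choose (2 * m) m : ℂ) /
      (Nat.choose (4 * m + 1) m : ℂ)) * gbinomC (y + m) (3 * m + 1) *
        gbinomC (y - 1) (3 * m + 1) := fun y => by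
    simp only [Q, eval_mul, eval_C, gpoly_eval, sub_eq_add_neg]
  have hPQ : P = Q := by
    apply Polynomial.eq_of_infinite_eval_eq
    apply Set.infinite_of_injective_forall_mem (f := fun n : ℕ => ((3 * m + 1 + n : ℕ) : ℂ))
    · intro a b hab
      have := Nat.cast_injective (R := ℂ) hab
      omega
    · intro n
      show P.eval _ = Q.eval _
      rw [hP, hQ]
      exact main_nat m n
  rw [← hP, ← hQ, hPQ]

theorem stmt3 (t : ℂ) (m : ℕ) (hm : 0 < m) :
    ∑ k ∈ Finset.range (2 * m + 1),
        (-1 : ℂ) ^ k * (Nat.choose (2 * m) k : ℂ) *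
          gbinomC (t + 1/2) (4 * m + 1 - k) * gbinomC (t - 1/2) (2 * m + 1 + k)
      = ((-1 : ℂ) ^ m * (Nat.choose (2 * m) m : ℂ) / (Nat.choose (4 * m + 1) m : ℂ)) *
          gbinomC (t + m + 1/2) (3 * m + 1) * gbinomC (t - 1/2) (3 * m + 1) := by
  have h := main_all m (t + 1/2)
  rw [lhsS, show t + 1/2 - 1 = t - 1/2 by ring, show t + 1/2 + (m : ℂ) = t + m + 1/2 by ring] at h
  exact h
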